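/- Let (J₁, J₂) be a linear generalized Kähler structure on 𝕍 = V × V* with G = −J₁∘J₂, let K ⊆ V* be a subspace, and set W_K = Ann(K + J₁(K) + J₂(K) + G(K)). Then the restriction of the pairing ⟨,⟩ to W_K is nondegenerate: if x ∈ W_K satisfies ⟨x, y⟩ = 0 for all y ∈ W_K, then x = 0. (Nondegeneracy claim of Lemma kahler:sequence.) -/

import Mathlib

/-- The generalized tangent space `𝕍 = V × V*`. -/
abbrev GV (V : Type*) [AddCommGroup V] [Module ℝ V] := V × Module.Dual ℝ V

variable (V : Type*) [AddCommGroup V] [Module ℝ V] [FiniteDimensional ℝ V]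

/-- The canonical symmetric pairing `⟨(X,ξ),(Y,η)⟩ = (1/2)(η X + ξ Y)` on `𝕍`. -/
noncomputable def pairForm : LinearMap.BilinForm ℝ (GV V) :=
  LinearMap.mk₂ ℝ (fun u v => (1 / 2 : ℝ) * (v.2 u.1 + u.2 v.1))
    (fun u u' v => by simp; ring)
    (fun c u v => by simp; ring)
    (fun u v v' => by simp; ring)
    (fun c u v => by simp; ring)

/-- `V* = {0} × V*` as a subspace of `𝕍`. -/
def VStar : Submodule ℝ (GV V) := LinearMap.range (LinearMap.inr ℝ V (Module.Dual ℝ V))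

variable {V}

/-- The annihilator of a subspace of `𝕍` with respect to the canonical pairing. -/
noncomputable def Ann (S : Submodule ℝ (GV V)) : Submodule ℝ (GV V) where
  carrier := {u : GV V | ∀ s ∈ S, pairForm V u s = 0}
  add_mem' := fun ha hb s hs => by simp [ha s hs, hb s hs]
  zero_mem' := fun s hs => by simp
  smul_mem' := fun c a ha s hs => by simp [ha s hs]

/-- The image in `𝕍` of a subspace `K ⊆ V*`. -/
def ofDual (K : Submodule ℝ (Module.Dual ℝ V)) : Submodule ℝ (GV V) :=
  K.map (LinearMap.inr ℝ V (Module.Dual ℝ V))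

/-- A linear generalized complex structure on `𝕍`. -/
structure IsGenCx (J : GV V →ₗ[ℝ] GV V) : Prop where
  sq : ∀ u, J (J u) = -u
  orth : ∀ u v, pairForm V (J u) (J v) = pairForm V u v

/-- A linear generalized Kähler structure on `𝕍`: two commuting linear generalized
complex structures such that `G = -J₁∘J₂` gives a positive definite form `⟨G·,·⟩`. -/
structure IsGenKahler (J₁ J₂ : GV V →ₗ[ℝ] GV V) : Prop where
  cx1 : IsGenCx J₁
  cx2 : IsGenCx J₂
  comm : ∀ u, J₁ (J₂ u) = J₂ (J₁ u)
  posdef : ∀ u : GV V, u ≠ 0 → 0 < pairForm V (-(J₁ (J₂ u))) u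

theorem pairForm_comm (u v : GV V) : pairForm V u v = pairForm V v u := by
  simp [pairForm, add_comm]

/-- The product of two commuting generalized complex structures is self-adjoint. -/
theorem pairForm_comp_left {J₁ J₂ : GV V →ₗ[ℝ] GV V} (h₁ : IsGenCx J₁) (h₂ : IsGenCx J₂)
    (hc : ∀ u, J₁ (J₂ u) = J₂ (J₁ u)) (u v : GV V) :
    pairForm V (J₁ (J₂ u)) v = pairForm V u (J₁ (J₂ v)) := by
  rw [← h₁.orth, h₁.sq, map_neg, LinearMap.neg_apply, ← h₂.orth, h₂.sq, map_neg,
    LinearMap.neg_apply, neg_neg, hc]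

/-- `K + J₁K + J₂K + GK` is stable under `J₁J₂`. -/
theorem comp_mem_sup {J₁ J₂ : GV V →ₗ[ℝ] GV V} (h₁ : IsGenCx J₁) (h₂ : IsGenCx J₂)
    (hc : ∀ u, J₁ (J₂ u) = J₂ (J₁ u)) (L : Submodule ℝ (GV V)) {s : GV V}
    (hs : s ∈ L ⊔ L.map J₁ ⊔ L.map J₂ ⊔ L.map (-(J₁ ∘ₗ J₂))) :
    J₁ (J₂ s) ∈ L ⊔ L.map J₁ ⊔ L.map J₂ ⊔ L.map (-(J₁ ∘ₗ J₂)) := by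
  simp only [Submodule.mem_sup, Submodule.mem_map] at hs ⊢
  obtain ⟨_, ⟨_, ⟨a, ha, _, ⟨b, hb, rfl⟩, rfl⟩, _, ⟨c, hcL, rfl⟩, rfl⟩, _, ⟨d, hd, rfl⟩, rfl⟩ := hs
  refine ⟨_, ⟨_, ⟨-d, L.neg_mem hd, _, ⟨-c, L.neg_mem hcL, rfl⟩, rfl⟩, _,
    ⟨-b, L.neg_mem hb, rfl⟩, rfl⟩, _, ⟨-a, L.neg_mem ha, rfl⟩, ?_⟩
  have hb' : J₁ (J₂ (J₁ b)) = -J₂ b := by rw [← hc, h₁.sq]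
  have hd' : J₁ (J₂ (J₁ (J₂ d))) = d := by rw [← hc (J₂ d), h₁.sq, h₂.sq, neg_neg]
  simp only [LinearMap.neg_apply, LinearMap.comp_apply, map_add, map_neg, h₂.sq, hb', hd']
  abel

/-- nondegeneracy claim of Lemma kahler:sequence: the restriction
of `⟨,⟩` to `W_K = Ann(K + J₁K + J₂K + GK)` is nondegenerate. -/
theorem statement7 {V : Type*} [AddCommGroup V] [Module ℝ V] [FiniteDimensional ℝ V]
    (J₁ J₂ : GV V →ₗ[ℝ] GV V) (h : IsGenKahler J₁ J₂)
    (K : Submodule ℝ (Module.Dual ℝ V)) :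
    let G : GV V →ₗ[ℝ] GV V := -(J₁ ∘ₗ J₂)
    let Kv : Submodule ℝ (GV V) := ofDual K
    let W : Submodule ℝ (GV V) := Ann (Kv ⊔ Kv.map J₁ ⊔ Kv.map J₂ ⊔ Kv.map G)
    ∀ x ∈ W, (∀ y ∈ W, pairForm V x y = 0) → x = 0 := by
  intro G Kv W x hx hxW
  by_contra hne
  have hGx : -(J₁ (J₂ x)) ∈ W := W.neg_mem fun s hs => by
    rw [pairForm_comp_left h.cx1 h.cx2 h.comm]
    exact hx _ (comp_mem_sup h.cx1 h.cx2 h.comm Kv hs)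
  have hpos := h.posdef x hne
  rw [pairForm_comm, hxW _ hGx] at hpos
  exact lt_irrefl 0 hpos
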